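/- arXiv:2502.16621 — 6 statements merged into one kernel-verified Lean document; each statement's English description precedes it below -/
import Mathlib

section
/- Let X be a finite set and let L_1, …, L_k be subsets of X with X = L_1 ∪ … ∪ L_k such that for every x ∈ X the index set {i : x ∈ L_i} is a nonempty set of consecutive integers. For each i ∈ {1,…,k} let P_i be a set of linear orders of L_i. Then the following are equivalent: (a) there exists a linear order σ of X such that for every i the restriction of σ to L_i belongs to P_i; (b) there exist linear orders σ_1 ∈ P_1, …, σ_k ∈ P_k such that for every i ∈ {1,…,k−1} and all x, y ∈ L_i ∩ L_{i+1}, x ≤_{σ_i} y if and only if x ≤_{σ_{i+1}} y. -/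
/-- `σ` is a linear order of the subset `L` of `X`: it relates only elements of `L`,
is reflexive on `L`, transitive, antisymmetric, and total on `L`. -/
def IsLinOrderOn {X : Type*} (L : Set X) (σ : X → X → Prop) : Prop :=
  (∀ x y, σ x y → x ∈ L ∧ y ∈ L) ∧
  (∀ x ∈ L, σ x x) ∧
  (∀ x y z, σ x y → σ y z → σ x z) ∧
  (∀ x y, σ x y → σ y x → x = y) ∧
  (∀ x ∈ L, ∀ y ∈ L, σ x y ∨ σ y x)

/-- The restriction of the order `σ` to the subset `L`. -/
def restrictRel {X : Type*} (σ : X → X → Prop) (L : Set X) : X → X → Prop :=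
  fun x y => x ∈ L ∧ y ∈ L ∧ σ x y

/-- A linear order of `L` is determined by any linear order of a superset that extends it. -/
theorem IsLinOrderOn.iff_of_le {X : Type*} {L M : Set X} {τ ρ : X → X → Prop}
    (hτ : IsLinOrderOn L τ) (hρ : IsLinOrderOn M ρ) (hle : ∀ x y, τ x y → ρ x y)
    {x y : X} (hx : x ∈ L) (hy : y ∈ L) : ρ x y ↔ τ x y := by
  obtain ⟨-, -, -, -, τ_total⟩ := hτ
  obtain ⟨-, -, -, ρ_antisymm, -⟩ := hρ
  refine ⟨fun h => ?_, hle x y⟩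
  rcases τ_total x hx y hy with h' | h'
  · exact h'
  · obtain rfl := ρ_antisymm x y h (hle y x h')
    exact h'

/-- Two linear orders that agree on the intersection of their domains extend to a common
linear order of the union. -/
theorem IsLinOrderOn.exists_amalgam {X : Type*} {A B : Set X} {τ σ : X → X → Prop}
    (hτ : IsLinOrderOn A τ) (hσ : IsLinOrderOn B σ)
    (hagree : ∀ x ∈ A ∩ B, ∀ y ∈ A ∩ B, (τ x y ↔ σ x y)) :
    ∃ ρ : X → X → Prop, IsLinOrderOn (A ∪ B) ρ ∧
      (∀ x ∈ A, ∀ y ∈ A, (ρ x y ↔ τ x y)) ∧ (∀ x ∈ B, ∀ y ∈ B, (ρ x y ↔ σ x y)) := by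
  let R : X → X → Prop := fun x y =>
    x = y ∨ τ x y ∨ σ x y ∨ (∃ z, τ x z ∧ σ z y) ∨ (∃ z, σ x z ∧ τ z y)
  have R_partialOrder : IsPartialOrder X R := by
    obtain ⟨τ_mem, τ_refl, τ_trans, τ_antisymm, τ_total⟩ := hτ
    obtain ⟨σ_mem, σ_refl, σ_trans, σ_antisymm, σ_total⟩ := hσ
    simp only [Set.mem_inter_iff] at hagree
    exact
      { refl := fun x => Or.inl rfl
        trans := by
          rintro x y z (rfl | h | h | ⟨u, h, h'⟩ | ⟨u, h, h'⟩)
            (rfl | g | g | ⟨v, g, g'⟩ | ⟨v, g, g'⟩) <;> simp only [R] <;> grind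
        antisymm := by
          rintro x y (rfl | h | h | ⟨u, h, h'⟩ | ⟨u, h, h'⟩)
            (hxy | g | g | ⟨v, g, g'⟩ | ⟨v, g, g'⟩) <;> grind }
  obtain ⟨s, s_linearOrder, hRs⟩ := extend_partialOrder R
  have hρ : IsLinOrderOn (A ∪ B) (restrictRel s (A ∪ B)) :=
    ⟨fun x y h => ⟨h.1, h.2.1⟩, fun x hx => ⟨hx, hx, refl_of s x⟩,
      fun x y z h g => ⟨h.1, g.2.1, trans_of s h.2.2 g.2.2⟩,
      fun x y h g => antisymm_of s h.2.2 g.2.2,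
      fun x hx y hy => (total_of s x y).imp (fun h => ⟨hx, hy, h⟩) (fun h => ⟨hy, hx, h⟩)⟩
  refine ⟨_, hρ, fun x hx y hy => hτ.iff_of_le hρ (fun a b h => ?_) hx hy,
    fun x hx y hy => hσ.iff_of_le hρ (fun a b h => ?_) hx hy⟩
  · exact ⟨Or.inl (hτ.1 a b h).1, Or.inl (hτ.1 a b h).2, hRs a b (Or.inr (Or.inl h))⟩
  · exact ⟨Or.inr (hσ.1 a b h).1, Or.inr (hσ.1 a b h).2, hRs a b (Or.inr (Or.inr (Or.inl h)))⟩

/-- Let `X` be a finite set and `L 0, …, L (k-1)` subsets covering `X` such that for every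
`x ∈ X` the set of indices `i < k` with `x ∈ L i` is nonempty and consists of consecutive
integers. For each `i < k` let `P i` be a set of linear orders of `L i`. Then there is a
linear order `σ` of `X` whose restriction to each `L i` belongs to `P i` if and only if
there are linear orders `σ i ∈ P i` such that adjacent orders agree on the intersection
of their domains. -/
theorem sequential_orders_characterization
    {X : Type*} [Fintype X] (k : ℕ) (L : ℕ → Set X)
    (hcover : ∀ x : X, ∃ i < k, x ∈ L i)
    (hconsec : ∀ (x : X) (i m j : ℕ), i ≤ m → m ≤ j → j < k →
      x ∈ L i → x ∈ L j → x ∈ L m)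
    (P : ℕ → Set (X → X → Prop))
    (hP : ∀ i < k, ∀ σ ∈ P i, IsLinOrderOn (L i) σ) :
    (∃ σ : X → X → Prop, IsLinOrderOn Set.univ σ ∧
      ∀ i < k, restrictRel σ (L i) ∈ P i) ↔
    (∃ σs : ℕ → (X → X → Prop), (∀ i < k, σs i ∈ P i) ∧
      ∀ i : ℕ, i + 1 < k → ∀ x ∈ L i ∩ L (i + 1), ∀ y ∈ L i ∩ L (i + 1),
        (σs i x y ↔ σs (i + 1) x y)) := by
  constructor
  · rintro ⟨σ, -, hσ⟩
    refine ⟨fun i => restrictRel σ (L i), hσ, ?_⟩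
    rintro i - x ⟨hx, hx'⟩ y ⟨hy, hy'⟩
    simp [restrictRel, hx, hx', hy, hy']
  · rintro ⟨σs, hσs, hagree⟩
    have amalgam : ∀ n ≤ k, ∃ τ : X → X → Prop, IsLinOrderOn {x | ∃ i < n, x ∈ L i} τ ∧
        ∀ i < n, ∀ x ∈ L i, ∀ y ∈ L i, (τ x y ↔ σs i x y) := by
      intro n
      induction n with
      | zero => exact fun _ => ⟨fun _ _ => False, by simp [IsLinOrderOn], by simp⟩
      | succ n ih =>
        intro hn
        obtain ⟨τ, hτ, hτσ⟩ := ih (by lia)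
        have hinter : ∀ x ∈ {x | ∃ i < n, x ∈ L i} ∩ L n, ∃ m, n = m + 1 ∧ x ∈ L m := by
          rintro x ⟨⟨i, hi, hxi⟩, hxn⟩
          exact ⟨n - 1, by lia, hconsec x i (n - 1) n (by lia) (by lia) (by lia) hxi hxn⟩
        obtain ⟨ρ, hρ, hρτ, hρσ⟩ := hτ.exists_amalgam (hP n hn _ (hσs n hn)) (by
          intro x hx y hy
          obtain ⟨m, rfl, hxm⟩ := hinter x hx
          obtain ⟨m', hm', hym⟩ := hinter y hy
          obtain rfl : m = m' := by lia
          exact (hτσ m (by lia) x hxm y hym).trans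
            (hagree m hn x ⟨hxm, hx.2⟩ y ⟨hym, hy.2⟩))
        have hunion : {x | ∃ i < n + 1, x ∈ L i} = {x | ∃ i < n, x ∈ L i} ∪ L n := by
          ext x
          simp only [Nat.exists_lt_succ_right, Set.mem_ofPred_eq, Set.mem_union]
        refine ⟨ρ, hunion ▸ hρ, fun i hi x hx y hy => ?_⟩
        rcases Nat.lt_succ_iff_lt_or_eq.mp hi with hi | rfl
        · exact (hρτ x ⟨i, hi, hx⟩ y ⟨i, hi, hy⟩).trans (hτσ i hi x hx y hy)
        · exact hρσ x hx y hy
    obtain ⟨τ, hτ, hτσ⟩ := amalgam k le_rfl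
    have huniv : {x | ∃ i < k, x ∈ L i} = Set.univ := Set.eq_univ_of_forall hcover
    refine ⟨τ, huniv ▸ hτ, fun i hi => ?_⟩
    have hrestrict : restrictRel τ (L i) = σs i := by
      funext x y
      refine propext ⟨fun h => (hτσ i hi x h.1 y h.2.1).mp h.2.2, fun h => ?_⟩
      obtain ⟨hx, hy⟩ := (hP i hi _ (hσs i hi)).1 x y h
      exact ⟨hx, hy, (hτσ i hi x hx y hy).mpr h⟩
    exact hrestrict ▸ hσs i hi
end

section
/- Let A and B be finite sets, let σ_A be a strict linear order of A and σ_B a strict linear order of B, and suppose they agree on the intersection, i.e., for all x, y ∈ A ∩ B, x <_{σ_A} y if and only if x <_{σ_B} y. Define a relation R on A ∪ B by x R y if and only if (x, y ∈ A and x <_{σ_A} y) or (x, y ∈ B and x <_{σ_B} y). Then R, viewed as the edge relation of a directed graph on A ∪ B, is acyclic; equivalently, the transitive closure of R is irreflexive. -/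
/-- `σ` is a strict linear order of the subset `L` of `X`: it relates only elements of
`L`, is irreflexive, transitive, and trichotomous on `L`. -/
def IsStrictLinOrderOn {X : Type*} (L : Set X) (σ : X → X → Prop) : Prop :=
  (∀ x y, σ x y → x ∈ L ∧ y ∈ L) ∧
  (∀ x, ¬ σ x x) ∧
  (∀ x y z, σ x y → σ y z → σ x z) ∧
  (∀ x ∈ L, ∀ y ∈ L, x ≠ y → σ x y ∨ σ y x)

/-- The union of two strict linear orders of finite sets `A` and `B` that agree on
`A ∩ B`, viewed as the edge relation of a directed graph on `A ∪ B`, is acyclic;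
equivalently, its transitive closure is irreflexive. -/
theorem union_of_agreeing_strict_orders_acyclic
    {X : Type*} (A B : Set X) (hAfin : A.Finite) (hBfin : B.Finite)
    (σA σB : X → X → Prop)
    (hA : IsStrictLinOrderOn A σA) (hB : IsStrictLinOrderOn B σB)
    (hagree : ∀ x ∈ A ∩ B, ∀ y ∈ A ∩ B, (σA x y ↔ σB x y)) :
    ∀ z : X, ¬ Relation.TransGen
      (fun x y => (x ∈ A ∧ y ∈ A ∧ σA x y) ∨ (x ∈ B ∧ y ∈ B ∧ σB x y)) z z := by
  obtain ⟨memA, irreflA, transA, -⟩ := hA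
  obtain ⟨memB, irreflB, transB, -⟩ := hB
  have agree : ∀ x y, x ∈ A → x ∈ B → y ∈ A → y ∈ B → (σA x y ↔ σB x y) :=
    fun x y hxA hxB hyA hyB => hagree x ⟨hxA, hxB⟩ y ⟨hyA, hyB⟩
  -- Every path shortens to at most one step of each order, since an inner stretch of the
  -- path between two changes of order joins two points of `A ∩ B`.
  have short : ∀ x y, Relation.TransGen
      (fun x y => (x ∈ A ∧ y ∈ A ∧ σA x y) ∨ (x ∈ B ∧ y ∈ B ∧ σB x y)) x y →
      σA x y ∨ σB x y ∨ (∃ c, σA x c ∧ σB c y) ∨ (∃ c, σB x c ∧ σA c y) := by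
    intro x y h
    induction h with
    | single h => exact h.imp (fun h => h.2.2) (fun h => Or.inl h.2.2)
    | tail _ h ih =>
      rcases h with ⟨-, -, h⟩ | ⟨-, -, h⟩ <;>
        rcases ih with h' | h' | ⟨c, h₁, h₂⟩ | ⟨c, h₁, h₂⟩ <;> grind
  intro z hz
  rcases short z z hz with h | h | ⟨c, h₁, h₂⟩ | ⟨c, h₁, h₂⟩ <;> grind
end

section
/- Let X be a finite set and let L_1, …, L_k be subsets of X with X = L_1 ∪ … ∪ L_k such that for every x ∈ X the index set {i : x ∈ L_i} is a nonempty set of consecutive integers. Suppose σ_1, …, σ_k are linear orders of L_1, …, L_k respectively, such that for every i ∈ {1,…,k−1} and all x, y ∈ L_i ∩ L_{i+1}, x ≤_{σ_i} y if and only if x ≤_{σ_{i+1}} y. Define the relation σ on X by x ≤_σ y if and only if there exists i with x, y ∈ L_i and x ≤_{σ_i} y. Then the reflexive-transitive closure σ* of σ is antisymmetric, and hence a partial order of X. -/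
/-- A partial order `R` and a linear order `S` of a subset `A` that contains the restriction of
`R` to `A` have a common extension to a partial order whose restriction to `A` is `S`. -/
theorem exists_order_adjoin {X : Type*} {A : Set X} {R S : X → X → Prop}
    (hrefl : ∀ x, R x x) (htrans : ∀ x y z, R x y → R y z → R x z)
    (hanti : ∀ x y, R x y → R y x → x = y)
    (hS : IsLinOrderOn A S)
    (habs : ∀ x ∈ A, ∀ y ∈ A, R x y → S x y) :
    ∃ T : X → X → Prop, (∀ x, T x x) ∧ (∀ x y z, T x y → T y z → T x z) ∧
      (∀ x y, T x y → T y x → x = y) ∧ (∀ x y, R x y → T x y) ∧ (∀ x y, S x y → T x y) ∧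
      (∀ x ∈ A, ∀ y ∈ A, T x y → S x y) ∧
      (∀ x y, T x y → R x y ∨ ∃ a ∈ A, ∃ b ∈ A, R x a ∧ R b y) := by
  obtain ⟨hmem, -, hStrans, hSanti, -⟩ := hS
  refine ⟨fun x y => R x y ∨ ∃ a b, R x a ∧ S a b ∧ R b y, fun x => Or.inl (hrefl x),
    ?_, ?_, fun x y h => Or.inl h, fun x y h => Or.inr ⟨x, y, hrefl x, h, hrefl y⟩, ?_, ?_⟩
  · rintro x y z (h | ⟨a, b, h₁, h₂, h₃⟩) (h' | ⟨c, d, h₄, h₅, h₆⟩)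
    · exact Or.inl (htrans _ _ _ h h')
    · exact Or.inr ⟨c, d, htrans _ _ _ h h₄, h₅, h₆⟩
    · exact Or.inr ⟨a, b, h₁, h₂, htrans _ _ _ h₃ h'⟩
    · have hbc := habs b (hmem _ _ h₂).2 c (hmem _ _ h₅).1 (htrans _ _ _ h₃ h₄)
      exact Or.inr ⟨a, d, h₁, hStrans _ _ _ h₂ (hStrans _ _ _ hbc h₅), h₆⟩
  · have key : ∀ x y, R x y → (∃ a b, R y a ∧ S a b ∧ R b x) → x = y := by
      rintro x y h ⟨c, d, h₄, h₅, h₆⟩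
      have hdc := habs d (hmem _ _ h₅).2 c (hmem _ _ h₅).1
        (htrans _ _ _ h₆ (htrans _ _ _ h h₄))
      obtain rfl := hSanti _ _ h₅ hdc
      exact hanti _ _ h (htrans _ _ _ h₄ h₆)
    rintro x y (h | ⟨a, b, h₁, h₂, h₃⟩) (h' | ⟨c, d, h₄, h₅, h₆⟩)
    · exact hanti _ _ h h'
    · exact key x y h ⟨c, d, h₄, h₅, h₆⟩
    · exact (key y x h' ⟨a, b, h₁, h₂, h₃⟩).symm
    · have hbc := habs b (hmem _ _ h₂).2 c (hmem _ _ h₅).1 (htrans _ _ _ h₃ h₄)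
      have hda := habs d (hmem _ _ h₅).2 a (hmem _ _ h₂).1 (htrans _ _ _ h₆ h₁)
      obtain rfl := hSanti _ _ h₂ (hStrans _ _ _ hbc (hStrans _ _ _ h₅ hda))
      exact key x y (htrans _ _ _ h₁ h₃) ⟨c, d, h₄, h₅, h₆⟩
  · rintro x hx y hy (h | ⟨a, b, h₁, h₂, h₃⟩)
    · exact habs x hx y hy h
    · exact hStrans _ _ _ (habs x hx a (hmem _ _ h₂).1 h₁)
        (hStrans _ _ _ h₂ (habs b (hmem _ _ h₂).2 y hy h₃))
  · rintro x y (h | ⟨a, b, h₁, h₂, h₃⟩)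
    · exact Or.inl h
    · exact Or.inr ⟨a, (hmem _ _ h₂).1, b, (hmem _ _ h₂).2, h₁, h₃⟩

/-- The first `n` orders of a consecutive family of linear orders, adjacent ones agreeing on
common elements, have a common extension to a partial order that induces the last of them. -/
theorem exists_common_extension {X : Type*} (k : ℕ) (L : ℕ → Set X)
    (hconsec : ∀ (x : X) (i m j : ℕ), i ≤ m → m ≤ j → j < k →
      x ∈ L i → x ∈ L j → x ∈ L m)
    (σs : ℕ → (X → X → Prop))
    (hlin : ∀ i < k, IsLinOrderOn (L i) (σs i))
    (hagree : ∀ i : ℕ, i + 1 < k → ∀ x ∈ L i ∩ L (i + 1), ∀ y ∈ L i ∩ L (i + 1),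
      (σs i x y ↔ σs (i + 1) x y)) (n : ℕ) (hn : n ≤ k) :
    ∃ R : X → X → Prop, (∀ x, R x x) ∧ (∀ x y z, R x y → R y z → R x z) ∧
      (∀ x y, R x y → R y x → x = y) ∧ (∀ i < n, ∀ x y, σs i x y → R x y) ∧
      (∀ x y, R x y → x = y ∨ (∃ i < n, x ∈ L i) ∧ ∃ i < n, y ∈ L i) ∧
      (∀ i, i + 1 = n → ∀ x ∈ L i, ∀ y ∈ L i, R x y → σs i x y) := by
  induction n with
  | zero =>
    exact ⟨Eq, fun _ => rfl, fun _ _ _ => Eq.trans, fun _ _ h _ => h, by simp,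
      fun _ _ h => Or.inl h, by simp⟩
  | succ n ih =>
    obtain ⟨R, hrefl, htrans, hanti, hext, hsupp, hlast⟩ := ih (by omega)
    have habs : ∀ x ∈ L n, ∀ y ∈ L n, R x y → σs n x y := by
      intro x hx y hy h
      rcases hsupp x y h with rfl | ⟨⟨i, hi, hxi⟩, j, hj, hyj⟩
      · exact (hlin n hn).2.1 x hx
      · obtain ⟨m, rfl⟩ : ∃ m, n = m + 1 := ⟨n - 1, by omega⟩
        have hxm := hconsec x i m (m + 1) (by omega) (by omega) hn hxi hx
        have hym := hconsec y j m (m + 1) (by omega) (by omega) hn hyj hy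
        exact (hagree m hn x ⟨hxm, hx⟩ y ⟨hym, hy⟩).1 (hlast m rfl x hxm y hym h)
    obtain ⟨T, h₁, h₂, h₃, hRT, hST, hTS, hT⟩ :=
      exists_order_adjoin hrefl htrans hanti (hlin n hn) habs
    refine ⟨T, h₁, h₂, h₃, ?_, ?_, ?_⟩
    · intro i hi x y h
      rcases Nat.lt_succ_iff_lt_or_eq.1 hi with hi | rfl
      · exact hRT _ _ (hext i hi x y h)
      · exact hST _ _ h
    · intro x y h
      rcases hT x y h with h | ⟨a, ha, b, hb, hxa, hby⟩
      · rcases hsupp x y h with h | ⟨⟨i, hi, hxi⟩, j, hj, hyj⟩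
        · exact Or.inl h
        · exact Or.inr ⟨⟨i, by omega, hxi⟩, j, by omega, hyj⟩
      · right
        constructor
        · rcases hsupp x a hxa with rfl | ⟨⟨i, hi, hxi⟩, -⟩
          · exact ⟨n, by omega, ha⟩
          · exact ⟨i, by omega, hxi⟩
        · rcases hsupp b y hby with rfl | ⟨-, i, hi, hyi⟩
          · exact ⟨n, by omega, hb⟩
          · exact ⟨i, by omega, hyi⟩
    · intro i hi
      obtain rfl : i = n := by omega
      exact hTS

/-- Let `X` be a finite set and `L 0, …, L (k-1)` subsets covering `X` such that for every
`x ∈ X` the set of indices `i < k` with `x ∈ L i` is nonempty and consists of consecutive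
integers. If `σs 0, …, σs (k-1)` are linear orders of `L 0, …, L (k-1)` such that adjacent
orders agree on the common elements of their domains, then the reflexive-transitive
closure of the union relation `σ` (where `x ≤_σ y` iff `x, y ∈ L i` and `x ≤_{σs i} y`
for some `i < k`) is antisymmetric, hence a partial order of `X`. -/
theorem union_closure_is_partial_order
    {X : Type*} [Fintype X] (k : ℕ) (L : ℕ → Set X)
    (hcover : ∀ x : X, ∃ i < k, x ∈ L i)
    (hconsec : ∀ (x : X) (i m j : ℕ), i ≤ m → m ≤ j → j < k →
      x ∈ L i → x ∈ L j → x ∈ L m)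
    (σs : ℕ → (X → X → Prop))
    (hlin : ∀ i < k, IsLinOrderOn (L i) (σs i))
    (hagree : ∀ i : ℕ, i + 1 < k → ∀ x ∈ L i ∩ L (i + 1), ∀ y ∈ L i ∩ L (i + 1),
      (σs i x y ↔ σs (i + 1) x y)) :
    (∀ x y : X,
      Relation.ReflTransGen (fun x y => ∃ i < k, x ∈ L i ∧ y ∈ L i ∧ σs i x y) x y →
      Relation.ReflTransGen (fun x y => ∃ i < k, x ∈ L i ∧ y ∈ L i ∧ σs i x y) y x →
      x = y) ∧
    IsPartialOrder X
      (Relation.ReflTransGen (fun x y => ∃ i < k, x ∈ L i ∧ y ∈ L i ∧ σs i x y)) := by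
  obtain ⟨R, hrefl, htrans, hanti, hext, -, -⟩ :=
    exists_common_extension k L hconsec σs hlin hagree k le_rfl
  have hle : ∀ x y : X,
      Relation.ReflTransGen (fun x y => ∃ i < k, x ∈ L i ∧ y ∈ L i ∧ σs i x y) x y → R x y := by
    intro x y h
    induction h with
    | refl => exact hrefl x
    | tail _ h ih =>
      obtain ⟨i, hi, -, -, h⟩ := h
      exact htrans _ _ _ ih (hext i hi _ _ h)
  have hmain : ∀ x y : X,
      Relation.ReflTransGen (fun x y => ∃ i < k, x ∈ L i ∧ y ∈ L i ∧ σs i x y) x y →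
      Relation.ReflTransGen (fun x y => ∃ i < k, x ∈ L i ∧ y ∈ L i ∧ σs i x y) y x →
      x = y := fun x y h h' => hanti x y (hle x y h) (hle y x h')
  exact ⟨hmain, { refl := fun _ => .refl, trans := fun _ _ _ => .trans, antisymm := hmain }⟩
end

section
/- Let H and V be finite sets, E ⊆ H × V a relation, and ≼ a linear order of H. Then the instance ((H ∪ V, E), ≼) admits an HV-segment representation if and only if there exists a linear order τ of V such that for every h ∈ H there do not exist u, v, w ∈ V with u <_τ v <_τ w, (h,u) ∈ E, (h,w) ∈ E, v active at h, and (h,v) ∉ E. -/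
/-- `(y, l, r, x, b, t)` is an HV-segment representation of the instance given by the
bipartite relation `E ⊆ H × V` and the linear order on `H`:
(i) `y` is strictly monotone with respect to the order on `H`;
(ii) each horizontal segment `[l h, r h] × {y h}` and vertical segment
`{x v} × [b v, t v]` is nonempty;
(iii) the segments of `h` and `v` intersect iff `E h v`;
(iv) distinct vertical segments do not overlap. -/
def IsHVRep {H V : Type*} [LinearOrder H] (E : H → V → Prop)
    (y l r : H → ℝ) (x b t : V → ℝ) : Prop :=
  (∀ h h' : H, h < h' → y h < y h') ∧
  (∀ h, l h ≤ r h) ∧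
  (∀ v, b v ≤ t v) ∧
  (∀ h v, (l h ≤ x v ∧ x v ≤ r h ∧ b v ≤ y h ∧ y h ≤ t v) ↔ E h v) ∧
  (∀ v v', v ≠ v' → x v = x v' → t v < b v' ∨ t v' < b v)

/-- The vertical segment `v` is active at the horizontal segment `h` if `v` has
neighbors `h₁ ≼ h` and `h₂ ≽ h`. -/
def ActiveAt {H V : Type*} [LinearOrder H] (E : H → V → Prop) (v : V) (h : H) : Prop :=
  ∃ h₁ h₂ : H, E h₁ v ∧ E h₂ v ∧ h₁ ≤ h ∧ h ≤ h₂

/-- The points of a finite family of reals lying in a suitable interval are exactly those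
lying between two points indexed by `S`. -/
theorem exists_interval_iff_between {α : Type*} [Finite α] (f : α → ℝ) (S : Set α) :
    ∃ p : ℝ × ℝ, p.1 ≤ p.2 ∧ ∀ a, (p.1 ≤ f a ∧ f a ≤ p.2) ↔
      ∃ u ∈ S, ∃ w ∈ S, f u ≤ f a ∧ f a ≤ f w := by
  rcases S.eq_empty_or_nonempty with rfl | hS
  · obtain ⟨c, hc⟩ := (Set.finite_range f).exists_notMem
    refine ⟨(c, c), le_rfl, fun a => ?_⟩
    simp only [Set.mem_empty_iff_false, false_and, exists_false, iff_false]
    exact fun h => hc ⟨a, le_antisymm h.2 h.1⟩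
  · obtain ⟨u, hu, hu'⟩ := S.exists_min_image f S.toFinite hS
    obtain ⟨w, hw, hw'⟩ := S.exists_max_image f S.toFinite hS
    refine ⟨(f u, f w), hu' w hw, fun a => ⟨fun h => ⟨u, hu, w, hw, h⟩, ?_⟩⟩
    rintro ⟨u', h1, w', h2, h3, h4⟩
    exact ⟨(hu' u' h1).trans h3, h4.trans (hw' w' h2)⟩

/-- A linear order on a finite type is represented by a real-valued function. -/
theorem IsLinearOrder.exists_real_le_iff {α : Type*} [Finite α] (τ : α → α → Prop)
    (hτ : IsLinearOrder α τ) : ∃ x : α → ℝ, ∀ u v, x u ≤ x v ↔ τ u v := by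
  let _ : LinearOrder α :=
    { le := τ
      le_refl := hτ.refl
      le_trans := hτ.trans
      le_antisymm := hτ.antisymm
      le_total := hτ.total
      toDecidableLE := Classical.decRel _ }
  obtain ⟨e⟩ := Order.embedding_from_countable_to_dense α ℝ
  exact ⟨e, fun u v => e.le_iff_le⟩

theorem IsHVRep.exists_consecutive_order {H V : Type*} [LinearOrder H] {E : H → V → Prop}
    {y l r : H → ℝ} {x b t : V → ℝ} (hrep : IsHVRep E y l r x b t) :
    ∃ τ : V → V → Prop, IsLinearOrder V τ ∧
      ∀ h : H, ¬ ∃ u v w : V, (τ u v ∧ u ≠ v) ∧ (τ v w ∧ v ≠ w) ∧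
        E h u ∧ E h w ∧ ActiveAt E v h ∧ ¬ E h v := by
  obtain ⟨hy, -, hbt, hE, hdis⟩ := hrep
  have hmono : Monotone y := StrictMono.monotone fun a c => hy a c
  have hinj : ∀ u v, x u = x v → b u = b v → u = v := by
    intro u v hx hb
    by_contra hne
    rcases hdis u v hne hx with h | h <;> linarith [hbt u, hbt v]
  refine ⟨fun u v => toLex (x u, b u) ≤ toLex (x v, b v),
    { refl := fun _ => le_rfl
      trans := fun _ _ _ => le_trans
      antisymm := fun u v h h' => ?_
      total := fun _ _ => le_total _ _ }, ?_⟩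
  · have := toLex.injective (le_antisymm h h')
    exact hinj u v (congrArg Prod.fst this) (congrArg Prod.snd this)
  · rintro h ⟨u, v, w, ⟨huv, -⟩, ⟨hvw, -⟩, hu, hw, ⟨h₁, h₂, e₁, e₂, le₁, le₂⟩, hv⟩
    have hfst : ∀ {p q : V}, toLex (x p, b p) ≤ toLex (x q, b q) → x p ≤ x q := by
      intro p q hpq
      rcases Prod.Lex.toLex_le_toLex.1 hpq with h | h
      exacts [h.le, h.1.le]
    obtain ⟨hl, -⟩ := (hE h u).2 hu
    obtain ⟨-, hr, -⟩ := (hE h w).2 hw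
    obtain ⟨-, -, hb, -⟩ := (hE h₁ v).2 e₁
    obtain ⟨-, -, -, ht⟩ := (hE h₂ v).2 e₂
    exact hv ((hE h v).1 ⟨hl.trans (hfst huv), (hfst hvw).trans hr,
      hb.trans (hmono le₁), (hmono le₂).trans ht⟩)

theorem exists_isHVRep_of_consecutive_order {H V : Type*} [Finite H] [Finite V]
    [LinearOrder H] {E : H → V → Prop} {τ : V → V → Prop} (hτ : IsLinearOrder V τ)
    (hcons : ∀ h : H, ¬ ∃ u v w : V, (τ u v ∧ u ≠ v) ∧ (τ v w ∧ v ≠ w) ∧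
      E h u ∧ E h w ∧ ActiveAt E v h ∧ ¬ E h v) :
    ∃ (y l r : H → ℝ) (x b t : V → ℝ), IsHVRep E y l r x b t := by
  obtain ⟨y⟩ := Order.embedding_from_countable_to_dense H ℝ
  obtain ⟨x, hx⟩ := IsLinearOrder.exists_real_le_iff τ hτ
  choose p hp hp' using fun h => exists_interval_iff_between x {v | E h v}
  choose q hq hq' using fun v => exists_interval_iff_between y {h | E h v}
  refine ⟨y, fun h => (p h).1, fun h => (p h).2, x, fun v => (q v).1, fun v => (q v).2,
    fun _ _ h => y.strictMono h, hp, hq, fun h v => ⟨?_, fun hv => ?_⟩, ?_⟩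
  · rintro ⟨a₁, a₂, a₃, a₄⟩
    obtain ⟨u, hu, w, hw, huv, hvw⟩ := (hp' h v).1 ⟨a₁, a₂⟩
    obtain ⟨h₁, e₁, h₂, e₂, le₁, le₂⟩ := (hq' v h).1 ⟨a₃, a₄⟩
    by_contra hv
    refine hcons h ⟨u, v, w, ⟨(hx u v).1 huv, ?_⟩, ⟨(hx v w).1 hvw, ?_⟩, hu, hw,
      ⟨h₁, h₂, e₁, e₂, y.le_iff_le.1 le₁, y.le_iff_le.1 le₂⟩, hv⟩
    · rintro rfl
      exact hv hu
    · rintro rfl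
      exact hv hw
  · obtain ⟨a₁, a₂⟩ := (hp' h v).2 ⟨v, hv, v, hv, le_rfl, le_rfl⟩
    obtain ⟨a₃, a₄⟩ := (hq' v h).2 ⟨h, hv, h, hv, le_rfl, le_rfl⟩
    exact ⟨a₁, a₂, a₃, a₄⟩
  · intro v v' hne heq
    exact absurd (hτ.antisymm v v' ((hx v v').1 heq.le) ((hx v' v).1 heq.ge)) hne

/-- Combinatorial characterization of Semi-Fixed HV-Segment Intersection Graph
Recognition: the instance admits an HV-segment representation if and only if there is a
linear order `τ` of `V` such that, for every `h ∈ H`, no segment active at `h` but not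
intersecting `h` lies `τ`-between two segments intersecting `h`. -/
theorem hv_representation_iff_consecutive_order
    {H V : Type*} [Fintype H] [Fintype V] [LinearOrder H] (E : H → V → Prop) :
    (∃ (y l r : H → ℝ) (x b t : V → ℝ), IsHVRep E y l r x b t) ↔
    (∃ τ : V → V → Prop, IsLinearOrder V τ ∧
      ∀ h : H, ¬ ∃ u v w : V, (τ u v ∧ u ≠ v) ∧ (τ v w ∧ v ≠ w) ∧
        E h u ∧ E h w ∧ ActiveAt E v h ∧ ¬ E h v) := by
  constructor
  · rintro ⟨y, l, r, x, b, t, hrep⟩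
    exact hrep.exists_consecutive_order
  · rintro ⟨τ, hτ, hcons⟩
    exact exists_isHVRep_of_consecutive_order hτ hcons
end

section
/- Let H and V be finite sets, E ⊆ H × V a relation, and ≼ a linear order of H, and suppose the instance ((H ∪ V, E), ≼) admits an HV-segment representation given by functions y, ℓ, r : H → ℝ and x, b, t : V → ℝ. Then there exists a linear order τ of V such that for every h ∈ H there do not exist u, v, w ∈ V with u <_τ v <_τ w, (h,u) ∈ E, (h,w) ∈ E, v active at h, and (h,v) ∉ E. -/
/-- Ordering the vertical segments lexicographically by abscissa and lower endpoint separates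
distinct segments. -/
theorem IsHVRep.injective_toLex {H V : Type*} [LinearOrder H] {E : H → V → Prop}
    {y l r : H → ℝ} {x b t : V → ℝ} (hrep : IsHVRep E y l r x b t) :
    Function.Injective fun v => toLex (x v, b v) := by
  obtain ⟨-, -, hbt, -, hdisj⟩ := hrep
  intro v v' hvv'
  obtain ⟨hx, hb⟩ := Prod.ext_iff.mp (toLex.injective hvv')
  dsimp only at hx hb
  by_contra hne
  rcases hdisj v v' hne hx with h | h
  · linarith [hbt v]
  · linarith [hbt v']

/-- A vertical segment that is active at `h` meets the line spanned by `h`. -/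
theorem IsHVRep.mem_Icc_of_activeAt {H V : Type*} [LinearOrder H] {E : H → V → Prop}
    {y l r : H → ℝ} {x b t : V → ℝ} (hrep : IsHVRep E y l r x b t) {v : V} {h : H}
    (hv : ActiveAt E v h) : y h ∈ Set.Icc (b v) (t v) := by
  obtain ⟨hy, -, -, hE, -⟩ := hrep
  obtain ⟨h₁, h₂, hE₁, hE₂, hle₁, hle₂⟩ := hv
  have hmono : StrictMono y := fun h h' => hy h h'
  obtain ⟨-, -, hb, -⟩ := (hE h₁ v).mpr hE₁
  obtain ⟨-, -, -, ht⟩ := (hE h₂ v).mpr hE₂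
  exact ⟨hb.trans (hmono.monotone hle₁), (hmono.monotone hle₂).trans ht⟩

/-- Necessity: if the instance admits an HV-segment representation, then there is a
linear order `τ` of `V` such that, for every `h ∈ H`, no segment active at `h` but not
intersecting `h` lies `τ`-between two segments intersecting `h`. -/
theorem hv_representation_gives_consecutive_order
    {H V : Type*} [Fintype H] [Fintype V] [LinearOrder H] (E : H → V → Prop)
    (y l r : H → ℝ) (x b t : V → ℝ) (hrep : IsHVRep E y l r x b t) :
    ∃ τ : V → V → Prop, IsLinearOrder V τ ∧
      ∀ h : H, ¬ ∃ u v w : V, (τ u v ∧ u ≠ v) ∧ (τ v w ∧ v ≠ w) ∧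
        E h u ∧ E h w ∧ ActiveAt E v h ∧ ¬ E h v := by
  let _ : LinearOrder V := LinearOrder.lift' _ hrep.injective_toLex
  have hx : Monotone x := fun u v huv => by
    have h : toLex (x u, b u) ≤ toLex (x v, b v) := huv
    exact (Prod.Lex.toLex_le_toLex.mp h).elim le_of_lt fun h => h.1.le
  refine ⟨(· ≤ ·), inferInstance, ?_⟩
  rintro h ⟨u, v, w, ⟨huv, -⟩, ⟨hvw, -⟩, hEu, hEw, hact, hnE⟩
  obtain ⟨hb, ht⟩ := hrep.mem_Icc_of_activeAt hact
  have hE := hrep.2.2.2.1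
  exact hnE ((hE h v).mp ⟨((hE h u).mpr hEu).1.trans (hx huv),
    (hx hvw).trans ((hE h w).mpr hEw).2.1, hb, ht⟩)
end

section
/- Let V be a finite set, let A_1, …, A_k be subsets of V such that for every v ∈ V the index set {i : v ∈ A_i} is a set of consecutive integers, and let I_i ⊆ A_i for every i ∈ {1,…,k}. Then the following are equivalent: (a) there exists a linear order τ of V such that for every i ∈ {1,…,k} there do not exist u, v, w with u <_τ v <_τ w, u ∈ I_i, w ∈ I_i, v ∈ A_i, and v ∉ I_i; (b) there exist linear orders σ_1, …, σ_k of A_1, …, A_k respectively such that for every i the set I_i is consecutive in σ_i (no element of A_i ∖ I_i lies σ_i-between two elements of I_i), and for every i ∈ {1,…,k−1} and all u, v ∈ A_i ∩ A_{i+1}, u ≤_{σ_i} v if and only if u ≤_{σ_{i+1}} v. -/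
/-- Two linear orders of subsets that agree on the intersection of these subsets have a common
extension to a linear order of the whole type. -/
theorem IsLinOrderOn.exists_common_extension {V : Type*} {B C : Set V} {τ σ : V → V → Prop}
    (hτ : IsLinOrderOn B τ) (hσ : IsLinOrderOn C σ)
    (hagree : ∀ u ∈ B ∩ C, ∀ v ∈ B ∩ C, (τ u v ↔ σ u v)) :
    ∃ ρ : V → V → Prop, IsLinearOrder V ρ ∧ τ ≤ ρ ∧ σ ≤ ρ := by
  obtain ⟨hτm, -, hτt, hτa, -⟩ := hτ
  obtain ⟨hσm, -, hσt, hσa, -⟩ := hσ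
  have hτσ : ∀ u v, τ u v → u ∈ C → v ∈ C → σ u v := fun u v h hu hv =>
    (hagree u ⟨(hτm u v h).1, hu⟩ v ⟨(hτm u v h).2, hv⟩).1 h
  have hστ : ∀ u v, σ u v → u ∈ B → v ∈ B → τ u v := fun u v h hu hv =>
    (hagree u ⟨hu, (hσm u v h).1⟩ v ⟨hv, (hσm u v h).2⟩).2 h
  let r : V → V → Prop := fun x y =>
    x = y ∨ τ x y ∨ σ x y ∨ (∃ z, τ x z ∧ σ z y) ∨ (∃ z, σ x z ∧ τ z y)
  have hr : IsPartialOrder V r :=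
    { refl := fun x => Or.inl rfl
      trans := by
        intro x y z hxy hyz
        simp only [r] at hxy hyz ⊢
        grind
      antisymm := by
        intro x y hxy hyx
        simp only [r] at hxy hyx
        grind }
  obtain ⟨ρ, hρ, hle⟩ := extend_partialOrder r
  exact ⟨ρ, hρ, fun x y h => hle x y (Or.inr (Or.inl h)),
    fun x y h => hle x y (Or.inr (Or.inr (Or.inl h)))⟩

/-- The restriction of a linear order to a subset is a linear order of this subset. -/
theorem IsLinearOrder.isLinOrderOn {V : Type*} {τ : V → V → Prop} (hτ : IsLinearOrder V τ)
    (B : Set V) : IsLinOrderOn B (fun x y => x ∈ B ∧ y ∈ B ∧ τ x y) := by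
  refine ⟨fun x y h => ⟨h.1, h.2.1⟩, fun x hx => ⟨hx, hx, hτ.refl x⟩,
    fun x y z h h' => ⟨h.1, h'.2.1, hτ.trans _ _ _ h.2.2 h'.2.2⟩,
    fun x y h h' => hτ.antisymm _ _ h.2.2 h'.2.2, fun x hx y hy => ?_⟩
  exact (hτ.total x y).imp (fun h => ⟨hx, hy, h⟩) (fun h => ⟨hy, hx, h⟩)

/-- On the ordered subset, a linear order agrees with any linear order extending it. -/
theorem IsLinOrderOn.iff_of_le_s11 {V : Type*} {C : Set V} {σ ρ : V → V → Prop}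
    (hσ : IsLinOrderOn C σ) (hρ : IsLinearOrder V ρ) (hle : σ ≤ ρ) {u v : V}
    (hu : u ∈ C) (hv : v ∈ C) : σ u v ↔ ρ u v := by
  refine ⟨hle u v, fun h => (hσ.2.2.2.2 u hu v hv).elim id fun h' => ?_⟩
  obtain rfl := hρ.antisymm u v h (hle v u h')
  exact h'

/-- Linear orders of the members of a sequence of sets in which every element occurs at consecutive
indices have a common linear extension if orders at adjacent indices agree. -/
theorem exists_linearOrder_of_agree_adjacent {V : Type*} (k : ℕ) (A : ℕ → Set V)
    (hconsec : ∀ (v : V) (i m j : ℕ), i ≤ m → m ≤ j → j < k → v ∈ A i → v ∈ A j → v ∈ A m)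
    (σs : ℕ → V → V → Prop) (hσ : ∀ i < k, IsLinOrderOn (A i) (σs i))
    (hagree : ∀ i : ℕ, i + 1 < k → ∀ u ∈ A i ∩ A (i + 1), ∀ v ∈ A i ∩ A (i + 1),
      (σs i u v ↔ σs (i + 1) u v)) :
    ∀ n ≤ k, ∃ τ : V → V → Prop, IsLinearOrder V τ ∧
      ∀ i < n, ∀ u ∈ A i, ∀ v ∈ A i, (σs i u v ↔ τ u v) := by
  intro n
  induction n with
  | zero =>
    intro _
    have : IsPartialOrder V Eq :=
      { refl := Eq.refl
        trans := fun _ _ _ => Eq.trans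
        antisymm := fun _ _ h _ => h }
    obtain ⟨τ, hτ, -⟩ := extend_partialOrder (Eq : V → V → Prop)
    exact ⟨τ, hτ, fun i hi => absurd hi i.not_lt_zero⟩
  | succ n ih =>
    intro hn
    obtain ⟨τ, hτ, hτσ⟩ := ih (by omega)
    have hB := hτ.isLinOrderOn {v | ∃ i < n, v ∈ A i}
    obtain ⟨ρ, hρ, hτρ, hσρ⟩ := hB.exists_common_extension (hσ n hn) (by
      rintro u ⟨⟨i, hi, hui⟩, hun⟩ v ⟨⟨j, hj, hvj⟩, hvn⟩
      obtain ⟨m, rfl⟩ : ∃ m, n = m + 1 := ⟨n - 1, by omega⟩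
      have hum := hconsec u i m (m + 1) (by omega) (by omega) hn hui hun
      have hvm := hconsec v j m (m + 1) (by omega) (by omega) hn hvj hvn
      rw [← hagree m hn u ⟨hum, hun⟩ v ⟨hvm, hvn⟩, hτσ m (by omega) u hum v hvm]
      exact ⟨fun h => h.2.2, fun h => ⟨⟨i, hi, hui⟩, ⟨j, hj, hvj⟩, h⟩⟩)
    refine ⟨ρ, hρ, fun i hi u hu v hv => ?_⟩
    rcases Nat.lt_succ_iff_lt_or_eq.1 hi with h | rfl
    · rw [hτσ i h u hu v hv, ← hB.iff_of_le_s11 hρ hτρ ⟨i, h, hu⟩ ⟨i, h, hv⟩]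
      exact ⟨fun h' => ⟨⟨i, h, hu⟩, ⟨i, h, hv⟩, h'⟩, fun h' => h'.2.2⟩
    · exact (hσ i hn).iff_of_le_s11 hρ hσρ hu hv

/-- Let `V` be a finite set, `A 0, …, A (k-1)` subsets of `V` such that for every `v ∈ V`
the set of indices `i < k` with `v ∈ A i` consists of consecutive integers, and let
`I i ⊆ A i` for every `i < k`. Then there is a single linear order `τ` of `V` making each
`I i` consecutive within `A i` (no element of `A i \ I i` lies `τ`-between two elements of
`I i`) if and only if there are per-index linear orders `σ i` of `A i`, each making `I i`
consecutive within `A i`, that agree on common elements for adjacent indices. -/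
theorem global_order_iff_perlevel_orders
    {V : Type*} [Fintype V] (k : ℕ) (A I : ℕ → Set V)
    (hI : ∀ i < k, I i ⊆ A i)
    (hconsec : ∀ (v : V) (i m j : ℕ), i ≤ m → m ≤ j → j < k →
      v ∈ A i → v ∈ A j → v ∈ A m) :
    (∃ τ : V → V → Prop, IsLinearOrder V τ ∧
      ∀ i < k, ¬ ∃ u v w : V, (τ u v ∧ u ≠ v) ∧ (τ v w ∧ v ≠ w) ∧
        u ∈ I i ∧ w ∈ I i ∧ v ∈ A i ∧ v ∉ I i) ↔
    (∃ σs : ℕ → (V → V → Prop),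
      (∀ i < k, IsLinOrderOn (A i) (σs i)) ∧
      (∀ i < k, ¬ ∃ u v w : V, (σs i u v ∧ u ≠ v) ∧ (σs i v w ∧ v ≠ w) ∧
        u ∈ I i ∧ w ∈ I i ∧ v ∈ A i ∧ v ∉ I i) ∧
      (∀ i : ℕ, i + 1 < k → ∀ u ∈ A i ∩ A (i + 1), ∀ v ∈ A i ∩ A (i + 1),
        (σs i u v ↔ σs (i + 1) u v))) := by
  constructor
  · rintro ⟨τ, hτ, h⟩
    refine ⟨fun i x y => x ∈ A i ∧ y ∈ A i ∧ τ x y, fun i _ => hτ.isLinOrderOn (A i), ?_, ?_⟩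
    · rintro i hi ⟨u, v, w, ⟨huv, hne⟩, ⟨hvw, hne'⟩, hrest⟩
      exact h i hi ⟨u, v, w, ⟨huv.2.2, hne⟩, ⟨hvw.2.2, hne'⟩, hrest⟩
    · rintro i - u ⟨hu, hu'⟩ v ⟨hv, hv'⟩
      simp only [hu, hu', hv, hv']
  · rintro ⟨σs, hσ, h, hagree⟩
    obtain ⟨τ, hτ, hτσ⟩ :=
      exists_linearOrder_of_agree_adjacent k A hconsec σs hσ hagree k le_rfl
    refine ⟨τ, hτ, ?_⟩
    rintro i hi ⟨u, v, w, ⟨huv, hne⟩, ⟨hvw, hne'⟩, hu, hw, hv, hvI⟩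
    exact h i hi ⟨u, v, w, ⟨(hτσ i hi u (hI i hi hu) v hv).2 huv, hne⟩,
      ⟨(hτσ i hi v hv w (hI i hi hw)).2 hvw, hne'⟩, hu, hw, hv, hvI⟩
end
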